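/- arXiv:2201.11159 — 12 statements merged into one kernel-verified Lean document; each statement's English description precedes it below -/
import Mathlib

section
/- Let A, B, C be affinely independent points in the Euclidean plane, with a = dist B C, b = dist C A, c = dist A B and s = (a+b+c)/2. Let X be the point on segment BC with dist B X = s − b, Y the point on segment CA with dist C Y = s − c, and Z the point on segment AB with dist A Z = s − a (the intouch points). Then the three cevians AX, BY, CZ are concurrent: there exists a point G lying on the line through A and X, on the line through B and Y, and on the line through C and Z (this point is the Gergonne point of triangle ABC). -/
open EuclideanGeometry Real MeasureTheory RealInnerProductSpace

noncomputable def area (P Q R : EuclideanSpace ℝ (Fin 2)) : ℝ :=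
  (MeasureTheory.volume (convexHull ℝ ({P, Q, R} : Set (EuclideanSpace ℝ (Fin 2))))).toReal

theorem gerg_aux (P Q R X : EuclideanSpace ℝ (Fin 2)) (x y z D : ℝ)
    (hD : D = y * z + z * x + x * y) (hD0 : D ≠ 0) (hyz : dist Q R = y + z) (h0 : y + z ≠ 0)
    (hX : X ∈ segment ℝ Q R) (hXd : dist Q X = y) :
    (1 / D) • ((y * z) • P + (z * x) • Q + (x * y) • R) ∈
      affineSpan ℝ ({P, X} : Set (EuclideanSpace ℝ (Fin 2))) := by
  rw [segment_eq_image_lineMap] at hX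
  obtain ⟨θ, hθ, rfl⟩ := hX
  rw [dist_left_lineMap, hyz, Real.norm_of_nonneg hθ.1] at hXd
  have h1 : θ = y / (y + z) := by field_simp; linarith
  have key : (1 / D) • ((y * z) • P + (z * x) • Q + (x * y) • R) =
      AffineMap.lineMap P (AffineMap.lineMap Q R θ : EuclideanSpace ℝ (Fin 2))
        (x * (y + z) / D) := by
    ext i
    simp only [AffineMap.lineMap_apply, vsub_eq_sub, vadd_eq_add, PiLp.add_apply, PiLp.smul_apply,
      PiLp.sub_apply, smul_eq_mul]
    rw [h1]
    field_simp
    rw [hD]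
    ring
  rw [key]
  exact AffineMap.lineMap_mem_affineSpan_pair _ _ _

theorem gergonne_point_exists
    (A B C : EuclideanSpace ℝ (Fin 2))
    (hABC : AffineIndependent ℝ ![A, B, C])
    (a b c s : ℝ)
    (ha : a = dist B C) (hb : b = dist C A) (hc : c = dist A B)
    (hs : s = (a + b + c) / 2)
    (X Y Z : EuclideanSpace ℝ (Fin 2))
    (hX : X ∈ segment ℝ B C) (hXd : dist B X = s - b)
    (hY : Y ∈ segment ℝ C A) (hYd : dist C Y = s - c)
    (hZ : Z ∈ segment ℝ A B) (hZd : dist A Z = s - a) :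
    ∃ G : EuclideanSpace ℝ (Fin 2),
      G ∈ affineSpan ℝ ({A, X} : Set (EuclideanSpace ℝ (Fin 2))) ∧
      G ∈ affineSpan ℝ ({B, Y} : Set (EuclideanSpace ℝ (Fin 2))) ∧
      G ∈ affineSpan ℝ ({C, Z} : Set (EuclideanSpace ℝ (Fin 2))) := by
  have hAB : A ≠ B := fun h => by
    have := hABC.injective (a₁ := 0) (a₂ := 1) (by simpa using h)
    simp at this
  have hBC : B ≠ C := fun h => by
    have := hABC.injective (a₁ := 1) (a₂ := 2) (by simpa using h)
    simp at this
  have hCA : C ≠ A := fun h => by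
    have := hABC.injective (a₁ := 2) (a₂ := 0) (by simpa using h)
    simp at this
  have a0 : 0 < a := ha ▸ dist_pos.2 hBC
  have b0 : 0 < b := hb ▸ dist_pos.2 hCA
  have c0 : 0 < c := hc ▸ dist_pos.2 hAB
  have y0 : 0 ≤ s - b := hXd ▸ dist_nonneg
  have z0 : 0 ≤ s - c := hYd ▸ dist_nonneg
  have x0 : 0 ≤ s - a := hZd ▸ dist_nonneg
  have e1 : (s - b) + (s - c) = a := by linarith
  have e2 : (s - c) + (s - a) = b := by linarith
  have e3 : (s - a) + (s - b) = c := by linarith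
  generalize s - a = x at *
  generalize s - b = y at *
  generalize s - c = z at *
  have D0 : y * z + z * x + x * y ≠ 0 := by
    have h1 := mul_nonneg y0 z0
    have h2 := mul_nonneg z0 x0
    have h3 := mul_nonneg x0 y0
    intro h
    have h4 : y * z = 0 := by linarith
    have h5 : z * x = 0 := by linarith
    have h6 : x * y = 0 := by linarith
    rcases mul_eq_zero.1 h4 with h | h <;> rcases mul_eq_zero.1 h5 with h' | h' <;>
      rcases mul_eq_zero.1 h6 with h'' | h'' <;> linarith
  refine ⟨(1 / (y * z + z * x + x * y)) • ((y * z) • A + (z * x) • B + (x * y) • C), ?_, ?_, ?_⟩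
  · exact gerg_aux A B C X x y z _ rfl D0 (by linarith) (by linarith) hX hXd
  · convert gerg_aux B C A Y y z x (y * z + z * x + x * y) (by ring) D0 (by linarith) (by linarith) hY hYd using 2
    abel
  · convert gerg_aux C A B Z z x y (y * z + z * x + x * y) (by ring) D0 (by linarith) (by linarith) hZ hZd using 2
    abel
end

section
/- Let A, B, C be affinely independent points in the Euclidean plane, with a = dist B C, b = dist C A, c = dist A B, and let D be the Gergonne point of triangle ABC. Then (dist A D)^2 · (a² + b² + c² − 2ab − 2bc − 2ca)² = a·(b + c − a)³·(a·(a + b + c) − 2·(b − c)²). -/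
open EuclideanGeometry Real MeasureTheory RealInnerProductSpace

theorem gergonne_spoke_formula
    (A B C D : EuclideanSpace ℝ (Fin 2))
    (hABC : AffineIndependent ℝ ![A, B, C])
    (a b c s : ℝ)
    (ha : a = dist B C) (hb : b = dist C A) (hc : c = dist A B)
    (hs : s = (a + b + c) / 2)
    (X Y Z : EuclideanSpace ℝ (Fin 2))
    (hX : X ∈ segment ℝ B C) (hXd : dist B X = s - b)
    (hY : Y ∈ segment ℝ C A) (hYd : dist C Y = s - c)
    (hZ : Z ∈ segment ℝ A B) (hZd : dist A Z = s - a)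
    (hD1 : D ∈ affineSpan ℝ ({A, X} : Set (EuclideanSpace ℝ (Fin 2))))
    (hD2 : D ∈ affineSpan ℝ ({B, Y} : Set (EuclideanSpace ℝ (Fin 2))))
    (hD3 : D ∈ affineSpan ℝ ({C, Z} : Set (EuclideanSpace ℝ (Fin 2))))
    :
    (dist A D) ^ 2 * (a ^ 2 + b ^ 2 + c ^ 2 - 2 * a * b - 2 * b * c - 2 * c * a) ^ 2 =
      a * (b + c - a) ^ 3 * (a * (a + b + c) - 2 * (b - c) ^ 2) := by
  have hli : LinearIndependent ℝ ![B - A, C - A] := by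
    have h := (affineIndependent_iff_linearIndependent_vsub ℝ _ (0 : Fin 3)).1 hABC
    have h2 := h.comp (fun i : Fin 2 => (⟨i.succ, Fin.succ_ne_zero i⟩ : {x : Fin 3 // x ≠ 0}))
      (by intro i j hij; simpa using hij)
    have h3 : ![B - A, C - A] = (fun i : {x : Fin 3 // x ≠ 0} =>
        (![A, B, C] i -ᵥ ![A, B, C] 0 : EuclideanSpace ℝ (Fin 2))) ∘
        (fun i : Fin 2 => (⟨i.succ, Fin.succ_ne_zero i⟩ : {x : Fin 3 // x ≠ 0})) := by
      ext i j
      fin_cases i <;> simp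
    rw [h3]
    exact h2
  rw [LinearIndependent.pair_iff] at hli
  rw [segment_eq_image_lineMap] at hX hY
  obtain ⟨t, ⟨ht0, ht1⟩, rfl⟩ := hX
  obtain ⟨r, ⟨hr0, hr1⟩, rfl⟩ := hY
  obtain ⟨p, hp⟩ := (mem_affineSpan_pair_iff_exists_lineMap_eq).1 hD1
  obtain ⟨q, hq⟩ := (mem_affineSpan_pair_iff_exists_lineMap_eq).1 hD2
  have ht : t * a = s - b := by
    rw [← hXd, dist_left_lineMap, Real.norm_of_nonneg ht0, ← ha]
  have hr : r * b = s - c := by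
    rw [← hYd, dist_left_lineMap, Real.norm_of_nonneg hr0, ← hb]
  have hBC : B ≠ C := fun h => by
    have := hABC.injective.ne (show (1 : Fin 3) ≠ 2 by decide)
    simp [h] at this
  have hCA : C ≠ A := fun h => by
    have := hABC.injective.ne (show (2 : Fin 3) ≠ 0 by decide)
    simp [h] at this
  have ha0 : 0 < a := by rw [ha]; exact dist_pos.2 hBC
  have hb0 : 0 < b := by rw [hb]; exact dist_pos.2 hCA
  simp only [AffineMap.lineMap_apply, vsub_eq_sub, vadd_eq_add] at hp hq
  have hD : D - A = (p * (1 - t)) • (B - A) + (p * t) • (C - A) := by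
    rw [← hp]; module
  have hlin := hli (p * (1 - t) - (1 - q)) (p * t - q * (1 - r)) (by
    have h2 : D - A = (1 - q) • (B - A) + (q * (1 - r)) • (C - A) := by
      rw [← hq]; module
    have h3 := hD.symm.trans h2
    rw [← sub_eq_zero] at h3
    rw [← h3]; module)
  obtain ⟨h1, h2⟩ := hlin
  set u := B - A with hu
  set v := C - A with hv
  have hc2 : c ^ 2 = inner ℝ u u := by
    rw [real_inner_self_eq_norm_sq, hc, dist_comm, dist_eq_norm]
  have hb2 : b ^ 2 = inner ℝ v v := by
    rw [real_inner_self_eq_norm_sq, hb, dist_eq_norm]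
  have ha2 : a ^ 2 = inner ℝ u u - 2 * inner ℝ u v + inner ℝ v v := by
    rw [← real_inner_sub_sub_self, real_inner_self_eq_norm_sq, ha, dist_eq_norm]
    congr 2; rw [hu, hv]; abel
  have hAD : dist A D ^ 2 = (p * (1 - t)) ^ 2 * c ^ 2 + (p * t) ^ 2 * b ^ 2
      + (p * (1 - t)) * (p * t) * (b ^ 2 + c ^ 2 - a ^ 2) := by
    rw [dist_comm, dist_eq_norm, hD, ← real_inner_self_eq_norm_sq, ha2, hb2, hc2]
    simp only [inner_add_left, inner_add_right, real_inner_smul_left, real_inner_smul_right,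
      real_inner_comm u v]
    ring
  obtain ⟨x, y, z, rfl, rfl, rfl⟩ : ∃ x y z : ℝ, a = y + z ∧ b = z + x ∧ c = x + y :=
    ⟨s - a, s - b, s - c, by rw [hs]; ring, by rw [hs]; ring, by rw [hs]; ring⟩
  clear ha2 hb2 hc2 ha hb hc
  have hty : t * (y + z) = y := by rw [ht, hs]; ring
  have hrz : r * (z + x) = z := by rw [hr, hs]; ring
  have htz : (1 - t) * (y + z) = z := by linear_combination -hty
  have hq' : q = 1 - p * (1 - t) := by linear_combination h1
  subst hq'
  have hS : p * (x * y + y * z + z * x) = x * (y + z) := by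
    linear_combination (y + z) * (z + x) * h2 - p * (z + x) * hty - p * x * htz
      - (1 - p * (1 - t)) * (y + z) * hrz
  have hα : p * (1 - t) * (x * y + y * z + z * x) = x * z := by
    linear_combination (1 - t) * hS + x * htz
  have hβ : p * t * (x * y + y * z + z * x) = x * y := by
    linear_combination t * hS + x * hty
  rw [hAD]
  generalize p * (1 - t) = α at *
  generalize p * t = β at *
  have e : ∀ S : ℝ, (α ^ 2 * (x + y) ^ 2 + β ^ 2 * (z + x) ^ 2
      + α * β * ((z + x) ^ 2 + (x + y) ^ 2 - (y + z) ^ 2)) * (-4 * S) ^ 2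
      = 16 * ((α * S) ^ 2 * (x + y) ^ 2 + (β * S) ^ 2 * (z + x) ^ 2
      + (α * S) * (β * S) * ((z + x) ^ 2 + (x + y) ^ 2 - (y + z) ^ 2)) := by
    intro S; ring
  have e2 := e (x * y + y * z + z * x)
  rw [hα, hβ] at e2
  linear_combination e2
end

section
/- Let A, B, C be affinely independent points in the Euclidean plane, with a = dist B C, b = dist C A, c = dist A B, and let D be the Gergonne point of triangle ABC. Write x = dist D A and y = dist D B. Then x² · (c + a − b)² · b·(c + a − b)·(b² + bc − 2c² + ab + 4ca − 2a²) = y² · (b + c − a)² · a·(b + c − a)·(a² + ab − 2b² + ac + 4bc − 2c²). -/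
open EuclideanGeometry Real MeasureTheory RealInnerProductSpace

theorem gergonne_tripolar
    (A B C D : EuclideanSpace ℝ (Fin 2))
    (hABC : AffineIndependent ℝ ![A, B, C])
    (a b c s : ℝ)
    (ha : a = dist B C) (hb : b = dist C A) (hc : c = dist A B)
    (hs : s = (a + b + c) / 2)
    (X Y Z : EuclideanSpace ℝ (Fin 2))
    (hX : X ∈ segment ℝ B C) (hXd : dist B X = s - b)
    (hY : Y ∈ segment ℝ C A) (hYd : dist C Y = s - c)
    (hZ : Z ∈ segment ℝ A B) (hZd : dist A Z = s - a)
    (hD1 : D ∈ affineSpan ℝ ({A, X} : Set (EuclideanSpace ℝ (Fin 2))))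
    (hD2 : D ∈ affineSpan ℝ ({B, Y} : Set (EuclideanSpace ℝ (Fin 2))))
    (hD3 : D ∈ affineSpan ℝ ({C, Z} : Set (EuclideanSpace ℝ (Fin 2))))
    (x y : ℝ) (hx : x = dist D A) (hy : y = dist D B) :
    x ^ 2 * (c + a - b) ^ 2 *
        (b * (c + a - b) * (b ^ 2 + b * c - 2 * c ^ 2 + a * b + 4 * c * a - 2 * a ^ 2)) =
      y ^ 2 * (b + c - a) ^ 2 *
        (a * (b + c - a) * (a ^ 2 + a * b - 2 * b ^ 2 + a * c + 4 * b * c - 2 * c ^ 2)) := by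
  have hli := (affineIndependent_iff_linearIndependent_vsub ℝ _ (0 : Fin 3)).1 hABC
  have hli2 : ∀ m n : ℝ, m • (B - A) + n • (C - A) = 0 → m = 0 ∧ n = 0 := by
    have h2 : LinearIndependent ℝ ![B - A, C - A] := by
      have h3 := hli.comp (fun i : Fin 2 => (⟨i.succ, Fin.succ_ne_zero i⟩ : {x : Fin 3 // x ≠ 0}))
        (by intro i j h; simpa using h)
      have h4 : ![B - A, C - A] = ((fun i : {x : Fin 3 // x ≠ 0} => ![A, B, C] i -ᵥ ![A, B, C] 0) ∘
          fun i : Fin 2 => (⟨i.succ, Fin.succ_ne_zero i⟩ : {x : Fin 3 // x ≠ 0})) := by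
        ext i j
        fin_cases i <;> simp
      rw [h4]
      exact h3
    exact fun m n h => LinearIndependent.pair_iff.1 h2 m n h
  have hAB : A ≠ B := fun h => by
    have := hABC.injective.ne (show (0 : Fin 3) ≠ 1 by decide)
    exact this (by simpa using h)
  have hBC : B ≠ C := fun h => by
    have := hABC.injective.ne (show (1 : Fin 3) ≠ 2 by decide)
    exact this (by simpa using h)
  have hCA : C ≠ A := fun h => by
    have := hABC.injective.ne (show (2 : Fin 3) ≠ 0 by decide)
    exact this (by simpa using h)
  have a0 : 0 < a := ha ▸ dist_pos.2 hBC
  have b0 : 0 < b := hb ▸ dist_pos.2 hCA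
  have c0 : 0 < c := hc ▸ dist_pos.2 hAB
  have hq : 0 ≤ s - b := hXd ▸ dist_nonneg
  have hr : 0 ≤ s - c := hYd ▸ dist_nonneg
  have hp : 0 ≤ s - a := hZd ▸ dist_nonneg
  rw [segment_eq_image_lineMap] at hX hY
  obtain ⟨t, ⟨ht0, ht1⟩, rfl⟩ := hX
  obtain ⟨k, ⟨hk0, hk1⟩, rfl⟩ := hY
  obtain ⟨l, hl'⟩ := vadd_left_mem_affineSpan_pair.1
    (by rw [vsub_vadd]; exact hD1 : (D -ᵥ A) +ᵥ A ∈ _)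
  obtain ⟨m, hm'⟩ := vadd_left_mem_affineSpan_pair.1
    (by rw [vsub_vadd]; exact hD2 : (D -ᵥ B) +ᵥ B ∈ _)
  have hl := eq_vadd_iff_vsub_eq _ _ _ |>.2 hl'.symm
  have hm := eq_vadd_iff_vsub_eq _ _ _ |>.2 hm'.symm
  rw [← AffineMap.lineMap_apply, eq_comm] at hl hm
  rw [dist_left_lineMap, ← ha, Real.norm_of_nonneg ht0] at hXd
  rw [dist_left_lineMap, ← hb, Real.norm_of_nonneg hk0] at hYd
  have key := hli2 (l * (1 - t) - 1 + m) (l * t - m * (1 - k)) (by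
    have h := hl.trans hm.symm
    simp only [AffineMap.lineMap_apply, vsub_eq_sub, vadd_eq_add] at h
    ext i
    have h' := congrArg (fun v : EuclideanSpace ℝ (Fin 2) => v i) h
    simp at h' ⊢
    linear_combination h')
  obtain ⟨k1, k2⟩ := key
  have ea : a ^ 2 = (B 0 - C 0) ^ 2 + (B 1 - C 1) ^ 2 := by
    rw [ha, EuclideanSpace.dist_sq_eq]; simp [Fin.sum_univ_two, Real.dist_eq, sq_abs]
  have eb : b ^ 2 = (C 0 - A 0) ^ 2 + (C 1 - A 1) ^ 2 := by
    rw [hb, EuclideanSpace.dist_sq_eq]; simp [Fin.sum_univ_two, Real.dist_eq, sq_abs]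
  have ec : c ^ 2 = (A 0 - B 0) ^ 2 + (A 1 - B 1) ^ 2 := by
    rw [hc, EuclideanSpace.dist_sq_eq]; simp [Fin.sum_univ_two, Real.dist_eq, sq_abs]
  have ex : x ^ 2 = l ^ 2 * ((1 - t) ^ 2 * c ^ 2 + t ^ 2 * b ^ 2
      + t * (1 - t) * (b ^ 2 + c ^ 2 - a ^ 2)) := by
    rw [hx, EuclideanSpace.dist_sq_eq, ← hl, ea, eb, ec]
    simp [Fin.sum_univ_two, mul_pow, sq_abs, AffineMap.lineMap_apply]
    ring
  have ey : y ^ 2 = m ^ 2 * ((1 - k) ^ 2 * a ^ 2 + k ^ 2 * c ^ 2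
      + k * (1 - k) * (a ^ 2 + c ^ 2 - b ^ 2)) := by
    rw [hy, EuclideanSpace.dist_sq_eq, ← hm, ea, eb, ec]
    simp [Fin.sum_univ_two, mul_pow, sq_abs, AffineMap.lineMap_apply]
    ring
  clear hl hm hl' hm' hli hli2 ea eb ec hx hy ha hb hc hD1 hD2 hD3
  obtain ⟨p, hp'⟩ : ∃ p, p = s - a := ⟨_, rfl⟩
  obtain ⟨q, hq'⟩ : ∃ q, q = s - b := ⟨_, rfl⟩
  obtain ⟨r, hr'⟩ : ∃ r, r = s - c := ⟨_, rfl⟩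
  rw [← hp'] at hp
  rw [← hq'] at hq hXd
  rw [← hr'] at hr hYd
  have e1 : a = q + r := by linarith
  have e2 : b = r + p := by linarith
  have e3 : c = p + q := by linarith
  clear hp' hq' hr' hs hZd
  have hta : (1 - t) * a = r := by linarith
  have hkb : (1 - k) * b = p := by linarith
  have f1 : l * r = (1 - m) * a := by rw [← hta]; linear_combination a * k1
  have f2 : l * q * b = m * p * a := by
    rw [← hXd, ← hkb]; linear_combination a * b * k2
  have hS : 0 < p * q + q * r + r * p := by
    rcases hp.eq_or_lt with h | h
    · subst h
      have : 0 < q * r := mul_pos (by linarith) (by linarith)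
      linarith
    · have : 0 < p * (q + r) := mul_pos h (by linarith)
      nlinarith [mul_nonneg hq hr]
  have gl : l * (p * q + q * r + r * p) = a * p := by
    rw [e2] at f2
    linear_combination p * f1 + f2
  have gm : m * (p * q + q * r + r * p) = b * q := by
    apply mul_left_cancel₀ a0.ne'
    rw [e2, e1]
    rw [e1] at f1 gl
    linear_combination (p * q + q * r + r * p) * f1 - r * gl
  have hx2 : x ^ 2 * (p * q + q * r + r * p) ^ 2
      = p ^ 2 * (r ^ 2 * c ^ 2 + q ^ 2 * b ^ 2 + q * r * (b ^ 2 + c ^ 2 - a ^ 2)) := by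
    calc _ = (l * (p * q + q * r + r * p)) ^ 2 * ((1 - t) ^ 2 * c ^ 2 + t ^ 2 * b ^ 2
      + t * (1 - t) * (b ^ 2 + c ^ 2 - a ^ 2)) := by rw [ex]; ring
      _ = p ^ 2 * (((1 - t) * a) ^ 2 * c ^ 2 + (t * a) ^ 2 * b ^ 2
        + (t * a) * ((1 - t) * a) * (b ^ 2 + c ^ 2 - a ^ 2)) := by rw [gl]; ring
      _ = _ := by rw [hta, hXd]
  have hy2 : y ^ 2 * (p * q + q * r + r * p) ^ 2
      = q ^ 2 * (p ^ 2 * a ^ 2 + r ^ 2 * c ^ 2 + r * p * (a ^ 2 + c ^ 2 - b ^ 2)) := by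
    calc _ = (m * (p * q + q * r + r * p)) ^ 2 * ((1 - k) ^ 2 * a ^ 2 + k ^ 2 * c ^ 2
      + k * (1 - k) * (a ^ 2 + c ^ 2 - b ^ 2)) := by rw [ey]; ring
      _ = q ^ 2 * (((1 - k) * b) ^ 2 * a ^ 2 + (k * b) ^ 2 * c ^ 2
        + (k * b) * ((1 - k) * b) * (a ^ 2 + c ^ 2 - b ^ 2)) := by rw [gm]; ring
      _ = _ := by rw [hkb, hYd]
  apply mul_right_cancel₀ (pow_pos hS 2).ne'
  clear ex ey k1 k2 f1 f2 gl gm hta hkb hXd hYd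
  subst e1 e2 e3
  linear_combination ((p + q + (q + r) - (r + p)) ^ 2 *
        ((r + p) * (p + q + (q + r) - (r + p)) * ((r + p) ^ 2 + (r + p) * (p + q) - 2 * (p + q) ^ 2 + (q + r) * (r + p) + 4 * (p + q) * (q + r) - 2 * (q + r) ^ 2))) * hx2 - ((r + p + (p + q) - (q + r)) ^ 2 *
        ((q + r) * (r + p + (p + q) - (q + r)) * ((q + r) ^ 2 + (q + r) * (r + p) - 2 * (r + p) ^ 2 + (q + r) * (p + q) + 4 * (r + p) * (p + q) - 2 * (p + q) ^ 2))) * hy2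
end

section
/- Let A, B, C be affinely independent points in the Euclidean plane, with a = dist B C, b = dist C A, c = dist A B, and let D be the Gergonne point of triangle ABC. Then (b + c − a) · area(B, D, C) = (c + a − b) · area(C, D, A), where area(P, Q, R) denotes the 2-dimensional Lebesgue measure of the convex hull of {P, Q, R}. -/
open EuclideanGeometry Real MeasureTheory RealInnerProductSpace

noncomputable def crossDet (P Q R : EuclideanSpace ℝ (Fin 2)) : ℝ :=
  (Q 0 - P 0) * (R 1 - P 1) - (R 0 - P 0) * (Q 1 - P 1)

lemma area_eq_crossDet (P Q R : EuclideanSpace ℝ (Fin 2)) :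
    area P Q R = |crossDet P Q R| * area 0 !₂[1, 0] !₂[0, 1] := by
  set M : Matrix (Fin 2) (Fin 2) ℝ := !![Q 0 - P 0, R 0 - P 0; Q 1 - P 1, R 1 - P 1] with hM
  set L : EuclideanSpace ℝ (Fin 2) →ₗ[ℝ] EuclideanSpace ℝ (Fin 2) :=
    Matrix.toLin (EuclideanSpace.basisFun (Fin 2) ℝ).toBasis
      (EuclideanSpace.basisFun (Fin 2) ℝ).toBasis M with hL
  have hdet : LinearMap.det L = crossDet P Q R := by
    rw [hL, LinearMap.det_toLin, Matrix.det_fin_two]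
    simp [hM, crossDet]
  have hLv : ∀ v : EuclideanSpace ℝ (Fin 2), ∀ i, L v i = M i 0 * v 0 + M i 1 * v 1 := by
    intro v i
    have h := congrFun (Matrix.toLin_apply (EuclideanSpace.basisFun (Fin 2) ℝ).toBasis
      (EuclideanSpace.basisFun (Fin 2) ℝ).toBasis M v ▸ rfl :
        (fun j => L v j) = fun j => (∑ k, (M.mulVec
          ((EuclideanSpace.basisFun (Fin 2) ℝ).toBasis.repr v)) k •
          (EuclideanSpace.basisFun (Fin 2) ℝ).toBasis k) j) i
    fin_cases i <;> simpa [Matrix.mulVec, dotProduct, Fin.sum_univ_two] using h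
  have himg : (convexHull ℝ ({P, Q, R} : Set (EuclideanSpace ℝ (Fin 2)))) =
      (P + ·) '' (L '' convexHull ℝ ({0, !₂[1, 0], !₂[0, 1]} : Set (EuclideanSpace ℝ (Fin 2)))) := by
    rw [L.image_convexHull]
    have h1 : L !₂[1, 0] = Q - P := by
      ext i; rw [hLv]; fin_cases i <;> simp [hM]
    have h2 : L !₂[0, 1] = R - P := by
      ext i; rw [hLv]; fin_cases i <;> simp [hM]
    rw [Set.image_insert_eq, Set.image_insert_eq, Set.image_singleton, h1, h2, map_zero]
    have := AffineMap.image_convexHull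
      ((AffineEquiv.constVAdd ℝ (EuclideanSpace ℝ (Fin 2)) P).toAffineMap)
      ({0, Q - P, R - P} : Set (EuclideanSpace ℝ (Fin 2)))
    have h3 : (fun x => P + x) =
      ⇑((AffineEquiv.constVAdd ℝ (EuclideanSpace ℝ (Fin 2)) P).toAffineMap) := by
      ext x; simp
    rw [h3, this, ← h3, Set.image_insert_eq, Set.image_insert_eq, Set.image_singleton]
    simp
  unfold area
  rw [himg, Set.image_add_left, measure_preimage_add, Measure.addHaar_image_linearMap, hdet,
    ENNReal.toReal_mul, ENNReal.toReal_ofReal (abs_nonneg _)]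

lemma seg_coord {P Q X : EuclideanSpace ℝ (Fin 2)} (h : X ∈ segment ℝ P Q) :
    ∃ t : ℝ, (∀ i, X i = P i + t * (Q i - P i)) ∧ dist P X = t * dist P Q := by
  rw [segment_eq_image_lineMap] at h
  obtain ⟨t, ht, rfl⟩ := h
  refine ⟨t, fun i => ?_, ?_⟩
  · simp [AffineMap.lineMap_apply]; ring
  · rw [dist_left_lineMap, Real.norm_of_nonneg ht.1]

lemma line_coord {P Q X : EuclideanSpace ℝ (Fin 2)}
    (h : X ∈ affineSpan ℝ ({P, Q} : Set (EuclideanSpace ℝ (Fin 2)))) :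
    ∃ t : ℝ, ∀ i, X i = P i + t * (Q i - P i) := by
  obtain ⟨t, rfl⟩ := open AffineSubspace in mem_affineSpan_pair_iff_exists_lineMap_eq.1 h
  exact ⟨t, fun i => by simp [AffineMap.lineMap_apply]; ring⟩

theorem gergonne_barycentric
    (A B C D : EuclideanSpace ℝ (Fin 2))
    (hABC : AffineIndependent ℝ ![A, B, C])
    (a b c s : ℝ)
    (ha : a = dist B C) (hb : b = dist C A) (hc : c = dist A B)
    (hs : s = (a + b + c) / 2)
    (X Y Z : EuclideanSpace ℝ (Fin 2))
    (hX : X ∈ segment ℝ B C) (hXd : dist B X = s - b)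
    (hY : Y ∈ segment ℝ C A) (hYd : dist C Y = s - c)
    (hZ : Z ∈ segment ℝ A B) (hZd : dist A Z = s - a)
    (hD1 : D ∈ affineSpan ℝ ({A, X} : Set (EuclideanSpace ℝ (Fin 2))))
    (hD2 : D ∈ affineSpan ℝ ({B, Y} : Set (EuclideanSpace ℝ (Fin 2))))
    (hD3 : D ∈ affineSpan ℝ ({C, Z} : Set (EuclideanSpace ℝ (Fin 2))))
    :
    (b + c - a) * area B D C = (c + a - b) * area C D A := by
  obtain ⟨θ, hXc, hθ⟩ := seg_coord hX
  obtain ⟨φ, hYc, hφ⟩ := seg_coord hY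
  obtain ⟨t, ht⟩ := line_coord hD1
  obtain ⟨u, hu⟩ := line_coord hD2
  rw [hXd, ← ha] at hθ
  rw [hYd, ← hb] at hφ
  have hx : 0 ≤ b + c - a := by
    have := dist_nonneg (x := A) (y := Z)
    rw [hZd] at this; linarith
  have hy : 0 ≤ c + a - b := by
    have := dist_nonneg (x := B) (y := X)
    rw [hXd] at this; linarith
  set S := crossDet A B C with hS
  have e1 : crossDet B D C = -(1 - t) * S := by
    simp only [hS, crossDet, ht, hXc]; ring
  have e1' : crossDet B D C = -(u * φ) * S := by
    simp only [hS, crossDet, hu, hYc]; ring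
  have e2 : crossDet C D A = -(t * (1 - θ)) * S := by
    simp only [hS, crossDet, ht, hXc]; ring
  have e3 : crossDet A D B = -(t * θ) * S := by
    simp only [hS, crossDet, ht, hXc]; ring
  have e3' : crossDet A D B = -(u * (1 - φ)) * S := by
    simp only [hS, crossDet, hu, hYc]; ring
  have k3 : t * θ * S = u * (1 - φ) * S := by linarith
  have hb' : b + c - a = 2 * (b * (1 - φ)) := by linarith
  have ha' : c + a - b = 2 * (a * θ) := by linarith
  have hz : a * (1 - θ) = φ * b := by linarith
  have key : (b + c - a) * crossDet B D C = (c + a - b) * crossDet C D A := by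
    rw [e1', e2, hb', ha']
    linear_combination (2 * b * φ) * k3 + 2 * t * θ * S * hz
  rw [area_eq_crossDet B D C, area_eq_crossDet C D A, ← mul_assoc, ← mul_assoc]
  congr 1
  have k := congrArg abs key
  rwa [abs_mul, abs_mul, abs_of_nonneg hx, abs_of_nonneg hy] at k
end

section
/- Let A, B, C be affinely independent points in the Euclidean plane, with a = dist B C, b = dist C A, c = dist A B, s = (a+b+c)/2, and let D be the Gergonne point of triangle ABC. Then area(B, C, D) · (2ab + 2bc + 2ca − a² − b² − c²) = (a + b − c)·(a − b + c)·K, where K = √(s(s−a)(s−b)(s−c)) and area(P, Q, R) denotes the 2-dimensional Lebesgue measure of the convex hull of {P, Q, R}. -/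
open EuclideanGeometry Real MeasureTheory RealInnerProductSpace

def stdTri : Set (ℝ × ℝ) := {p | 0 ≤ p.1 ∧ 0 ≤ p.2 ∧ p.1 + p.2 ≤ 1}

lemma stdTri_closed : IsClosed stdTri := by
  unfold stdTri
  refine (isClosed_le continuous_const continuous_fst).inter
    ((isClosed_le continuous_const continuous_snd).inter
      (isClosed_le (continuous_fst.add continuous_snd) continuous_const))

lemma stdTri_convex : Convex ℝ stdTri := by
  rintro ⟨p, q⟩ ⟨h1, h2, h3⟩ ⟨p', q'⟩ ⟨h1', h2', h3'⟩ u v hu hv huv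
  simp only [stdTri, Set.mem_ofPred_eq, Prod.smul_mk, Prod.mk_add_mk, smul_eq_mul] at *
  refine ⟨by positivity, by positivity, ?_⟩
  nlinarith [mul_le_mul_of_nonneg_left h3 hu, mul_le_mul_of_nonneg_left h3' hv]

lemma stdTri_volume : volume stdTri = ENNReal.ofReal (1 / 2) := by
  rw [Measure.volume_eq_prod, Measure.prod_apply stdTri_closed.measurableSet]
  have h : ∀ x : ℝ, volume (Prod.mk x ⁻¹' stdTri)
      = (Set.Icc (0:ℝ) 1).indicator (fun x => ENNReal.ofReal (1 - x)) x := by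
    intro x
    by_cases hx : x ∈ Set.Icc (0:ℝ) 1
    · rw [Set.indicator_of_mem hx]
      have : Prod.mk x ⁻¹' stdTri = Set.Icc 0 (1 - x) := by
        ext y
        simp only [stdTri, Set.mem_preimage, Set.mem_ofPred_eq, Set.mem_Icc]
        constructor
        · rintro ⟨_, h2, h3⟩; exact ⟨h2, by linarith⟩
        · rintro ⟨h2, h3⟩; exact ⟨hx.1, h2, by linarith⟩
      rw [this, Real.volume_Icc, sub_zero]
    · rw [Set.indicator_of_notMem hx]
      have : Prod.mk x ⁻¹' stdTri = ∅ := by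
        ext y
        simp only [stdTri, Set.mem_preimage, Set.mem_ofPred_eq, Set.mem_empty_iff_false, iff_false]
        rintro ⟨h1, h2, h3⟩
        exact hx ⟨h1, by linarith⟩
      rw [this, measure_empty]
  simp_rw [h]
  rw [lintegral_indicator measurableSet_Icc, ← ofReal_integral_eq_lintegral_ofReal]
  · congr 1
    rw [integral_Icc_eq_integral_Ioc, ← intervalIntegral.integral_of_le zero_le_one]
    rw [intervalIntegral.integral_sub (by simp) (by simp)]
    norm_num
  · exact (Continuous.integrableOn_Icc (by fun_prop))
  · filter_upwards [ae_restrict_mem measurableSet_Icc] with x hx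
    simpa using hx.2

def stdT : Set (EuclideanSpace ℝ (Fin 2)) := {p | 0 ≤ p 0 ∧ 0 ≤ p 1 ∧ p 0 + p 1 ≤ 1}

lemma stdT_volume : volume stdT = ENNReal.ofReal (1 / 2) := by
  have h1 := (volume_preserving_finTwoArrow ℝ).comp
    (EuclideanSpace.volume_preserving_symm_measurableEquiv_toLp (Fin 2)).symm.symm
  have := h1.measure_preimage stdTri_closed.measurableSet.nullMeasurableSet
  rw [← stdTri_volume, ← this]
  rfl

lemma stdT_convex : Convex ℝ stdT := by
  rintro p ⟨h1, h2, h3⟩ q ⟨h1', h2', h3'⟩ u v hu hv huv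
  simp only [stdT, Set.mem_ofPred_eq, PiLp.add_apply, PiLp.smul_apply, smul_eq_mul] at *
  refine ⟨by positivity, by positivity, ?_⟩
  nlinarith [mul_le_mul_of_nonneg_left h3 hu, mul_le_mul_of_nonneg_left h3' hv]

noncomputable def triMap (u v : EuclideanSpace ℝ (Fin 2)) :
    EuclideanSpace ℝ (Fin 2) →ₗ[ℝ] EuclideanSpace ℝ (Fin 2) :=
  Matrix.toLin (EuclideanSpace.basisFun (Fin 2) ℝ).toBasis (EuclideanSpace.basisFun (Fin 2) ℝ).toBasis
    !![u 0, v 0; u 1, v 1]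

lemma triMap_det (u v : EuclideanSpace ℝ (Fin 2)) :
    LinearMap.det (triMap u v) = u 0 * v 1 - v 0 * u 1 := by
  rw [triMap, LinearMap.det_toLin, Matrix.det_fin_two_of]

lemma triMap_apply (u v p : EuclideanSpace ℝ (Fin 2)) :
    triMap u v p = p 0 • u + p 1 • v := by
  ext i
  fin_cases i <;>
  simp [triMap, Matrix.toLin_apply, Matrix.mulVec, dotProduct, Fin.sum_univ_two] <;> ring

lemma hull_eq (P Q R : EuclideanSpace ℝ (Fin 2)) :
    convexHull ℝ ({P, Q, R} : Set (EuclideanSpace ℝ (Fin 2))) =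
      (fun x => P + x) '' (triMap (Q - P) (R - P) '' stdT) := by
  apply subset_antisymm
  · apply convexHull_min
    · rintro x (rfl | rfl | rfl)
      · exact ⟨0, ⟨0, by simp [stdT], by simp⟩, by simp⟩
      · exact ⟨_, ⟨!₂[1, 0], by simp [stdT], rfl⟩, by simp [triMap_apply]⟩
      · exact ⟨_, ⟨!₂[0, 1], by simp [stdT], rfl⟩, by simp [triMap_apply]⟩
    · exact (stdT_convex.linear_image _).translate P
  · rintro _ ⟨_, ⟨p, ⟨h0, h1, h2⟩, rfl⟩, rfl⟩
    have hc := convex_convexHull ℝ ({P, Q, R} : Set (EuclideanSpace ℝ (Fin 2)))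
    have hs := hc.sum_mem (t := Finset.univ) (w := ![1 - p 0 - p 1, p 0, p 1]) (z := ![P, Q, R])
      (by intro i _; fin_cases i <;> simp <;> linarith)
      (by simp [Fin.sum_univ_three]; try ring)
      (by intro i _; apply subset_convexHull; fin_cases i <;> simp)
    convert hs using 1
    simp only [triMap_apply, Fin.sum_univ_three]
    simp
    module

lemma area_eq (P Q R : EuclideanSpace ℝ (Fin 2)) :
    area P Q R = |(Q 0 - P 0) * (R 1 - P 1) - (R 0 - P 0) * (Q 1 - P 1)| / 2 := by
  rw [area, hull_eq, Set.image_add_left, measure_preimage_add,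
    Measure.addHaar_image_linearMap, stdT_volume, triMap_det,
    ENNReal.toReal_mul, ENNReal.toReal_ofReal (abs_nonneg _), ENNReal.toReal_ofReal (by norm_num)]
  simp
  ring

lemma cross_ne (A B C : EuclideanSpace ℝ (Fin 2)) (h : AffineIndependent ℝ ![A, B, C]) :
    (C 0 - B 0) * (A 1 - B 1) - (A 0 - B 0) * (C 1 - B 1) ≠ 0 := by
  intro h0
  rw [affineIndependent_iff] at h
  have key : ∀ i : Fin 2, C i - B i = 0 := by
    intro i
    have := h Finset.univ ![C i - B i, A i - C i, B i - A i] (by simp [Fin.sum_univ_three])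
      (by
        ext j
        fin_cases i <;> fin_cases j <;> simp [Fin.sum_univ_three] <;> linarith) 0 (by simp)
    simpa using this
  have := h Finset.univ ![0, 1, -1] (by simp [Fin.sum_univ_three]) (by
    ext j
    have := key j
    simp [Fin.sum_univ_three]; linarith) 1 (by simp)
  simp at this

lemma dist_sq (P Q : EuclideanSpace ℝ (Fin 2)) :
    dist P Q ^ 2 = (P 0 - Q 0) ^ 2 + (P 1 - Q 1) ^ 2 := by
  rw [EuclideanSpace.dist_eq, Real.sq_sqrt (by positivity)]
  simp [Fin.sum_univ_two, Real.dist_eq, sq_abs]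

lemma seg_point (B C X : EuclideanSpace ℝ (Fin 2)) (h : X ∈ segment ℝ B C) :
    ∃ t : ℝ, (∀ i, X i = B i + t * (C i - B i)) ∧ dist B X = t * dist B C := by
  rw [segment_eq_image'] at h
  obtain ⟨t, ht, rfl⟩ := h
  refine ⟨t, fun i => by simp, ?_⟩
  rw [dist_comm, dist_eq_norm, dist_comm B C, dist_eq_norm, add_sub_cancel_left, norm_smul,
    Real.norm_of_nonneg ht.1]

lemma line_point (A X D : EuclideanSpace ℝ (Fin 2))
    (h : D ∈ affineSpan ℝ ({A, X} : Set (EuclideanSpace ℝ (Fin 2)))) :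
    ∃ l : ℝ, ∀ i, D i = A i + l * (X i - A i) := by
  obtain ⟨l, rfl⟩ := mem_affineSpan_pair_iff_exists_lineMap_eq.1 h
  exact ⟨l, fun i => by simp [AffineMap.lineMap_apply]; ring⟩

theorem gergonne_area_formula
    (A B C D : EuclideanSpace ℝ (Fin 2))
    (hABC : AffineIndependent ℝ ![A, B, C])
    (a b c s : ℝ)
    (ha : a = dist B C) (hb : b = dist C A) (hc : c = dist A B)
    (hs : s = (a + b + c) / 2)
    (X Y Z : EuclideanSpace ℝ (Fin 2))
    (hX : X ∈ segment ℝ B C) (hXd : dist B X = s - b)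
    (hY : Y ∈ segment ℝ C A) (hYd : dist C Y = s - c)
    (hZ : Z ∈ segment ℝ A B) (hZd : dist A Z = s - a)
    (hD1 : D ∈ affineSpan ℝ ({A, X} : Set (EuclideanSpace ℝ (Fin 2))))
    (hD2 : D ∈ affineSpan ℝ ({B, Y} : Set (EuclideanSpace ℝ (Fin 2))))
    (hD3 : D ∈ affineSpan ℝ ({C, Z} : Set (EuclideanSpace ℝ (Fin 2))))
    :
    area B C D * (2 * a * b + 2 * b * c + 2 * c * a - a ^ 2 - b ^ 2 - c ^ 2) =
      (a + b - c) * (a - b + c) * Real.sqrt (s * (s - a) * (s - b) * (s - c)) := by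
  have hk := cross_ne A B C hABC
  obtain ⟨t, hXt, hXd'⟩ := seg_point B C X hX
  obtain ⟨r, hYr, hYd'⟩ := seg_point C A Y hY
  obtain ⟨l, hl⟩ := line_point A X D hD1
  obtain ⟨m, hm⟩ := line_point B Y D hD2
  have hx0 : 0 ≤ s - a := hZd ▸ dist_nonneg
  have hy0 : 0 ≤ s - b := hXd ▸ dist_nonneg
  have hz0 : 0 ≤ s - c := hYd ▸ dist_nonneg
  have hta : t * a = s - b := by rw [ha, ← hXd', hXd]
  have hrb : r * b = s - c := by rw [hb, ← hYd', hYd]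
  have ha2 := dist_sq B C
  have hb2 := dist_sq C A
  have hc2 := dist_sq A B
  rw [← ha] at ha2
  rw [← hb] at hb2
  rw [← hc] at hc2
  set k := (C 0 - B 0) * (A 1 - B 1) - (A 0 - B 0) * (C 1 - B 1) with hkdef
  -- Heron
  have heron : s * (s - a) * (s - b) * (s - c) = (k / 2) ^ 2 := by
    have e1 : s * (s - a) * (s - b) * (s - c)
        = (4 * a ^ 2 * c ^ 2 - (a ^ 2 + c ^ 2 - b ^ 2) ^ 2) / 16 := by rw [hs]; ring
    rw [e1, ha2, hb2, hc2, hkdef]; ring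
  have hpos : 0 < s * (s - a) * (s - b) * (s - c) := by rw [heron]; positivity
  have hx : 0 < s - a := by
    refine lt_of_le_of_ne hx0 fun h => ?_
    rw [← h] at hpos; simp at hpos
  have hy : 0 < s - b := by
    refine lt_of_le_of_ne hy0 fun h => ?_
    rw [← h] at hpos; simp at hpos
  have hz : 0 < s - c := by
    refine lt_of_le_of_ne hz0 fun h => ?_
    rw [← h] at hpos; simp at hpos
  rw [heron, Real.sqrt_sq_eq_abs, area_eq]
  have hD : (C 0 - B 0) * (D 1 - B 1) - (D 0 - B 0) * (C 1 - B 1) = (1 - l) * k := by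
    rw [hl, hl, hXt, hXt, hkdef]; ring
  -- barycentric comparison
  have E0 := (hl 0).symm.trans (hm 0)
  have E1 := (hl 1).symm.trans (hm 1)
  rw [hXt, hYr] at E0 E1
  have q1 : 1 - l = m * r := by
    apply mul_right_cancel₀ hk
    rw [hkdef]
    linear_combination (C 0 - B 0) * E1 - (C 1 - B 1) * E0
  have q2 : l * t = m * (1 - r) := by
    apply mul_right_cancel₀ hk
    rw [hkdef]
    linear_combination (A 1 - B 1) * E0 - (A 0 - B 0) * E1
  have hapos : 0 < a := by linarith
  have hbpos : 0 < b := by linarith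
  have hmain : (1 - l) * ((s - a) * a + (s - b) * (s - c)) = (s - b) * (s - c) := by
    have p1 : (1 - l) * b = m * (s - c) := by rw [q1, ← hrb]; ring
    have p2 : l * (s - b) * b = m * (s - a) * a := by
      have : s - a = (1 - r) * b := by linarith
      rw [this, ← hta]; linear_combination a * b * q2
    apply mul_right_cancel₀ hbpos.ne'
    linear_combination (s - a) * a * p1 - (s - c) * p2
  have hl0 : 0 ≤ 1 - l := by
    have h1 : 0 < (s - a) * a + (s - b) * (s - c) := by positivity
    have h2 : 0 < (s - b) * (s - c) := by positivity
    exact (pos_of_mul_pos_left (h2.trans_eq hmain.symm) h1.le).le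
  rw [hD, abs_mul, abs_of_nonneg hl0, abs_div, abs_two]
  rw [hs] at hmain
  linear_combination 2 * |k| * hmain
end

section
/- Let A, B, C be affinely independent points in the Euclidean plane, with a = dist B C, b = dist C A, c = dist A B, s = (a+b+c)/2. Let E be the point on segment BC with dist B E = s − b, and let D be the Gergonne point of triangle ABC. Then dist A D · (s − b)·(s − c) = dist D E · a·(s − a). -/
open EuclideanGeometry Real MeasureTheory RealInnerProductSpace

theorem gergonne_cevian_division
    (A B C D : EuclideanSpace ℝ (Fin 2))
    (hABC : AffineIndependent ℝ ![A, B, C])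
    (a b c s : ℝ)
    (ha : a = dist B C) (hb : b = dist C A) (hc : c = dist A B)
    (hs : s = (a + b + c) / 2)
    (E Y Z : EuclideanSpace ℝ (Fin 2))
    (hE : E ∈ segment ℝ B C) (hEd : dist B E = s - b)
    (hY : Y ∈ segment ℝ C A) (hYd : dist C Y = s - c)
    (hZ : Z ∈ segment ℝ A B) (hZd : dist A Z = s - a)
    (hD1 : D ∈ affineSpan ℝ ({A, E} : Set (EuclideanSpace ℝ (Fin 2))))
    (hD2 : D ∈ affineSpan ℝ ({B, Y} : Set (EuclideanSpace ℝ (Fin 2))))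
    (hD3 : D ∈ affineSpan ℝ ({C, Z} : Set (EuclideanSpace ℝ (Fin 2)))) :
    dist A D * ((s - b) * (s - c)) = dist D E * (a * (s - a)) := by
  have hli := (affineIndependent_iff_linearIndependent_vsub ℝ _ (0 : Fin 3)).1 hABC
  have hpair : ∀ m n : ℝ, m • (B - A) + n • (C - A) = 0 → m = 0 ∧ n = 0 := by
    intro m n h
    have h2 : LinearIndependent ℝ ![B - A, C - A] := by
      have := hli.comp (![⟨1, by decide⟩, ⟨2, by decide⟩] : Fin 2 → {x : Fin 3 // x ≠ 0})
        (by intro i j hij; fin_cases i <;> fin_cases j <;> simp_all)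
      have e : ((fun i : {x : Fin 3 // x ≠ 0} => (![A, B, C] i -ᵥ ![A, B, C] 0 :
          EuclideanSpace ℝ (Fin 2))) ∘ ![⟨1, by decide⟩, ⟨2, by decide⟩])
          = ![B - A, C - A] := by
        funext i
        fin_cases i <;> simp
      rw [← e]
      exact this
    exact LinearIndependent.pair_iff.1 h2 m n h
  have hapos : 0 < a := by
    rw [ha]; refine dist_pos.2 ?_
    rintro rfl
    have := hpair 1 (-1) (by module)
    norm_num at this
  have hbpos : 0 < b := by
    rw [hb]; refine dist_pos.2 ?_
    rintro rfl
    have := hpair 0 1 (by module)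
    norm_num at this
  have hcpos : 0 < c := by
    rw [hc]; refine dist_pos.2 ?_
    rintro rfl
    have := hpair 1 0 (by module)
    norm_num at this
  have hx : 0 ≤ s - a := hZd ▸ dist_nonneg
  have hy : 0 ≤ s - b := hEd ▸ dist_nonneg
  have hz : 0 ≤ s - c := hYd ▸ dist_nonneg
  rw [segment_eq_image'] at hE hY
  obtain ⟨t, ⟨ht0, -⟩, rfl⟩ := hE
  obtain ⟨u, ⟨hu0, -⟩, rfl⟩ := hY
  obtain ⟨p, rfl⟩ := mem_affineSpan_pair_iff_exists_lineMap_eq.1 hD1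
  obtain ⟨q, hq⟩ := mem_affineSpan_pair_iff_exists_lineMap_eq.1 hD2
  have hta : t * a = s - b := by
    rw [← hEd, ha, dist_eq_norm, dist_eq_norm, sub_add_cancel_left, norm_neg, norm_smul,
      Real.norm_of_nonneg ht0, norm_sub_rev]
  have hub : u * b = s - c := by
    rw [← hYd, hb, dist_eq_norm, dist_eq_norm, sub_add_cancel_left, norm_neg, norm_smul,
      Real.norm_of_nonneg hu0, norm_sub_rev]
  simp only [AffineMap.lineMap_apply, vsub_eq_sub, vadd_eq_add] at hq ⊢
  obtain ⟨h1, h2⟩ := hpair (p * (1 - t) - (1 - q)) (p * t - q * (1 - u)) (by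
    rw [← sub_eq_zero] at hq
    rw [← neg_eq_zero, ← hq]
    module)
  have hdl : dist A (p • (B + t • (C - B) - A) + A) = |p| * ‖B + t • (C - B) - A‖ := by
    rw [dist_comm, dist_eq_norm, add_sub_cancel_right, norm_smul, Real.norm_eq_abs]
  have hdr : dist (p • (B + t • (C - B) - A) + A) (B + t • (C - B))
      = |1 - p| * ‖B + t • (C - B) - A‖ := by
    rw [dist_comm, dist_eq_norm, ← Real.norm_eq_abs, ← norm_smul]
    congr 1
    module
  rw [hdl, hdr]
  generalize ‖B + t • (C - B) - A‖ = L
  clear hdl hdr hq hD1 hD2 hD3 hEd hYd hZd hpair hli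
  obtain ⟨x, hxe⟩ : ∃ x, x = s - a := ⟨_, rfl⟩
  obtain ⟨y, hye⟩ : ∃ y, y = s - b := ⟨_, rfl⟩
  obtain ⟨z, hze⟩ : ∃ z, z = s - c := ⟨_, rfl⟩
  have ea : a = y + z := by linarith
  have eb : b = x + z := by linarith
  have ec : c = x + y := by linarith
  rw [← hye, ← hze, ← hxe]
  rw [← hxe] at hx
  rw [← hye] at hy hta
  rw [← hze] at hz hub
  have k1 : p * z = a - q * a := by linear_combination a * h1 + p * hta - p * ea
  have k2 : p * y * b = q * x * a := by
    linear_combination a * b * h2 - p * b * hta - q * a * hub + q * a * eb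
  have hS : p * (x * y + y * z + z * x) = a * x := by
    rw [eb] at k2
    linear_combination k2 + x * k1
  have hS0 : 0 < x * y + y * z + z * x := by
    rw [ea] at hapos; rw [eb] at hbpos; rw [ec] at hcpos
    have := mul_nonneg hx hy
    have := mul_nonneg hy hz
    have := mul_nonneg hz hx
    rcases hx.eq_or_lt with h | h
    · subst h
      have := mul_pos (show 0 < y by linarith) (show 0 < z by linarith)
      linarith
    · have := mul_pos h hapos
      nlinarith
  have hS' : (1 - p) * (x * y + y * z + z * x) = y * z := by
    rw [ea] at hS
    linear_combination - hS
  have hp : 0 ≤ p := by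
    refine nonneg_of_mul_nonneg_left (b := x * y + y * z + z * x) ?_ hS0
    rw [hS]; positivity
  have hp' : 0 ≤ 1 - p := by
    refine nonneg_of_mul_nonneg_left (b := x * y + y * z + z * x) ?_ hS0
    rw [hS']; positivity
  rw [abs_of_nonneg hp, abs_of_nonneg hp']
  linear_combination (-p * L) * hS' + (1 - p) * L * hS
end

section
/- Let A, B, C be affinely independent points in the Euclidean plane, with a = dist B C, b = dist C A, c = dist A B, and let D be the Gergonne point of triangle ABC. Let E be the point on line AC such that the vector E − D is parallel to C − B (the Gergonne pararadius parallel to BC). Then dist D E · (2ab + 2bc + 2ca − a² − b² − c²) = a·(a + b − c)·(b + c − a). -/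
open EuclideanGeometry Real MeasureTheory RealInnerProductSpace

theorem gergonne_pararadius_formula
    (A B C D : EuclideanSpace ℝ (Fin 2))
    (hABC : AffineIndependent ℝ ![A, B, C])
    (a b c s : ℝ)
    (ha : a = dist B C) (hb : b = dist C A) (hc : c = dist A B)
    (hs : s = (a + b + c) / 2)
    (X Y Z : EuclideanSpace ℝ (Fin 2))
    (hX : X ∈ segment ℝ B C) (hXd : dist B X = s - b)
    (hY : Y ∈ segment ℝ C A) (hYd : dist C Y = s - c)
    (hZ : Z ∈ segment ℝ A B) (hZd : dist A Z = s - a)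
    (hD1 : D ∈ affineSpan ℝ ({A, X} : Set (EuclideanSpace ℝ (Fin 2))))
    (hD2 : D ∈ affineSpan ℝ ({B, Y} : Set (EuclideanSpace ℝ (Fin 2))))
    (hD3 : D ∈ affineSpan ℝ ({C, Z} : Set (EuclideanSpace ℝ (Fin 2))))
    (E : EuclideanSpace ℝ (Fin 2))
    (hE : E ∈ affineSpan ℝ ({A, C} : Set (EuclideanSpace ℝ (Fin 2))))
    (hEpar : ∃ t : ℝ, E - D = t • (C - B))
    :
    dist D E * (2 * a * b + 2 * b * c + 2 * c * a - a ^ 2 - b ^ 2 - c ^ 2) =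
      a * (a + b - c) * (b + c - a) := by
  have key : ∀ m n : ℝ, m • (B - A) + n • (C - A) = 0 → m = 0 ∧ n = 0 := by
    intro m n h
    have h1 := (affineIndependent_iff.1 hABC) Finset.univ ![-m - n, m, n]
      (by simp [Fin.sum_univ_three]; ring)
      (by
        simp only [Fin.sum_univ_three, Matrix.cons_val]
        rw [← h]; module)
    exact ⟨by simpa using h1 1 (Finset.mem_univ _), by simpa using h1 2 (Finset.mem_univ _)⟩
  have hane : a ≠ 0 := by
    intro h0
    have hBC : B = C := by rw [h0] at ha; exact dist_eq_zero.1 ha.symm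
    have := key 1 (-1) (by rw [hBC]; module)
    norm_num at this
  have hbne : b ≠ 0 := by
    intro h0
    have hCA : C = A := by rw [h0] at hb; exact dist_eq_zero.1 hb.symm
    have := key 0 1 (by rw [hCA]; module)
    norm_num at this
  have hx : 0 ≤ s - a := hZd ▸ dist_nonneg
  have hy : 0 ≤ s - b := hXd ▸ dist_nonneg
  have hz : 0 ≤ s - c := hYd ▸ dist_nonneg
  rw [segment_eq_image'] at hX hY
  obtain ⟨p, ⟨hp0, hp1⟩, rfl⟩ := hX
  obtain ⟨q, ⟨hq0, hq1⟩, rfl⟩ := hY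
  have hp : p * a = s - b := by
    rw [← hXd, ha, dist_eq_norm, dist_eq_norm, norm_sub_rev B C, sub_add_cancel_left, norm_neg,
      norm_smul, Real.norm_of_nonneg hp0]
  have hq : q * b = s - c := by
    rw [← hYd, hb, dist_eq_norm, dist_eq_norm, norm_sub_rev C A, sub_add_cancel_left, norm_neg,
      norm_smul, Real.norm_of_nonneg hq0]
  obtain ⟨d, rfl⟩ := (mem_affineSpan_pair_iff_exists_lineMap_eq).1 hD1
  obtain ⟨e, he⟩ := (mem_affineSpan_pair_iff_exists_lineMap_eq).1 hD2
  obtain ⟨f, rfl⟩ := (mem_affineSpan_pair_iff_exists_lineMap_eq).1 hE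
  obtain ⟨t, ht⟩ := hEpar
  have hdist : dist (AffineMap.lineMap A ((fun θ => B + θ • (C - B)) p) d)
      (AffineMap.lineMap A C f) = |t| * a := by
    rw [dist_comm, dist_eq_norm, ht, norm_smul, ha, dist_comm, dist_eq_norm, Real.norm_eq_abs]
  rw [hdist]
  simp only [AffineMap.lineMap_apply_module'] at he ht
  obtain ⟨k1, k2⟩ := key (d * (1 - p) - (1 - e)) (d * p - e * (1 - q)) (by
    rw [← sub_eq_zero] at he
    rw [← neg_eq_zero, ← he]; module)
  obtain ⟨k3, k4⟩ := key (t - d * (1 - p)) (f - d * p - t) (by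
    rw [← sub_eq_zero] at ht
    rw [← ht]; module)
  have hS : t * ((s-a)*(s-b) + (s-b)*(s-c) + (s-c)*(s-a)) = (s-a)*(s-c) := by
    have hp' : (1 - p) * a = s - c := by linarith
    have hq' : (1 - q) * b = s - a := by linarith
    have hd : d * (1 - q + p * q) = 1 - q := by linear_combination (1 - q) * k1 + k2
    have hSS : (s-a)*(s-b) + (s-b)*(s-c) + (s-c)*(s-a) = a * b * (1 - q + p * q) := by
      rw [← hp', ← hq', ← hp]
      linear_combination (p * a) * (hp' - hq)
    rw [hSS, ← hp', ← hq']
    linear_combination (a * b * (1 - q + p * q)) * k3 + (1-p) * a * b * hd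
  have hS' : |t| * ((s-a)*(s-b) + (s-b)*(s-c) + (s-c)*(s-a)) = (s-a)*(s-c) := by
    have h1 : 0 ≤ (s-a)*(s-b) + (s-b)*(s-c) + (s-c)*(s-a) := by positivity
    rw [← abs_of_nonneg h1, ← abs_mul, hS, abs_of_nonneg (mul_nonneg hx hz)]
  have e1 : 2 * a * b + 2 * b * c + 2 * c * a - a ^ 2 - b ^ 2 - c ^ 2 =
    4 * ((s-a)*(s-b) + (s-b)*(s-c) + (s-c)*(s-a)) := by rw [hs]; ring
  have e2 : a * (a + b - c) * (b + c - a) = 4 * a * ((s-a)*(s-c)) := by rw [hs]; ring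
  rw [e1, e2]
  linear_combination 4 * a * hS'
end

section
/- Let A, B, C be affinely independent points in the Euclidean plane, with a = dist B C, b = dist C A, c = dist A B, s = (a+b+c)/2, and let D be the Gergonne point of triangle ABC. Let E be the point on line AC such that the vector E − D is parallel to C − B. Then dist A E · (s − c) = dist D E · b. -/
open EuclideanGeometry Real MeasureTheory RealInnerProductSpace

theorem gergonne_parallel_ratio
    (A B C D : EuclideanSpace ℝ (Fin 2))
    (hABC : AffineIndependent ℝ ![A, B, C])
    (a b c s : ℝ)
    (ha : a = dist B C) (hb : b = dist C A) (hc : c = dist A B)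
    (hs : s = (a + b + c) / 2)
    (X Y Z : EuclideanSpace ℝ (Fin 2))
    (hX : X ∈ segment ℝ B C) (hXd : dist B X = s - b)
    (hY : Y ∈ segment ℝ C A) (hYd : dist C Y = s - c)
    (hZ : Z ∈ segment ℝ A B) (hZd : dist A Z = s - a)
    (hD1 : D ∈ affineSpan ℝ ({A, X} : Set (EuclideanSpace ℝ (Fin 2))))
    (hD2 : D ∈ affineSpan ℝ ({B, Y} : Set (EuclideanSpace ℝ (Fin 2))))
    (hD3 : D ∈ affineSpan ℝ ({C, Z} : Set (EuclideanSpace ℝ (Fin 2))))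
    (E : EuclideanSpace ℝ (Fin 2))
    (hE : E ∈ affineSpan ℝ ({A, C} : Set (EuclideanSpace ℝ (Fin 2))))
    (hEpar : ∃ t : ℝ, E - D = t • (C - B))
    :
    dist A E * (s - c) = dist D E * b := by
  obtain ⟨x, y, hx, hy, hxy, rfl⟩ := hX
  obtain ⟨p, rfl⟩ := mem_affineSpan_pair_iff_exists_lineMap_eq.1 hD1
  obtain ⟨q, rfl⟩ := mem_affineSpan_pair_iff_exists_lineMap_eq.1 hE
  obtain ⟨t, ht⟩ := hEpar
  have hx1 : x = 1 - y := by linarith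
  subst hx1
  have hli := (affineIndependent_iff_linearIndependent_vsub ℝ _ (0 : Fin 3)).1 hABC
  have hli2 : LinearIndependent ℝ ![B - A, C - A] := by
    have := hli.comp (fun i : Fin 2 => (⟨i.succ, Fin.succ_ne_zero i⟩ : {x : Fin 3 // x ≠ 0}))
      (by intro i j h; simpa using h)
    have e : ![B - A, C - A] = ((fun i : {x : Fin 3 // x ≠ 0} => ![A, B, C] ↑i -ᵥ ![A, B, C] 0) ∘
        fun i : Fin 2 => (⟨i.succ, Fin.succ_ne_zero i⟩ : {x : Fin 3 // x ≠ 0})) := by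
      funext i
      fin_cases i <;> simp
    rw [e]
    exact this
  rw [LinearIndependent.pair_iff] at hli2
  simp only [AffineMap.lineMap_apply, vsub_eq_sub, vadd_eq_add] at ht ⊢
  obtain ⟨h1, h2⟩ := hli2 (t - p * (1 - y)) (q - p * y - t) (by
    have h0 := sub_eq_zero.2 ht
    rw [← h0]
    module)
  have hq : q = p := by linarith
  subst hq
  have hXa : y * a = s - b := by
    rw [← hXd, ha, dist_eq_norm, dist_eq_norm,
      show B - ((1 - y) • B + y • C) = y • (B - C) by module, norm_smul, Real.norm_of_nonneg hy]
  have hA : dist A (q • (C - A) + A) = |q| * b := by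
    rw [hb, dist_eq_norm, dist_eq_norm, ← Real.norm_eq_abs, ← norm_smul, ← norm_neg]
    congr 1
    module
  have hDE : dist (q • ((1 - y) • B + y • C - A) + A) (q • (C - A) + A) = |q| * ((1 - y) * a) := by
    rw [ha, dist_eq_norm, dist_eq_norm, ← Real.norm_of_nonneg hx, ← Real.norm_eq_abs,
      ← norm_smul, ← norm_smul, Real.norm_of_nonneg hx]
    congr 1
    module
  rw [hA, hDE]
  have : (1 - y) * a = s - c := by linarith
  rw [this]
  ring
end

section
/- Let A, B, C be affinely independent points in the Euclidean plane, with a = dist B C, b = dist C A, c = dist A B, and let D be the Gergonne point of triangle ABC. Let E be the point on line AC such that the vector E − D is parallel to C − B. Then dist A E · (2ab + 2bc + 2ca − a² − b² − c²) = 2ab·(b + c − a) and dist C E · (2ab + 2bc + 2ca − a² − b² − c²) = b·(a + b − c)·(a − b + c). -/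
open EuclideanGeometry Real MeasureTheory RealInnerProductSpace

theorem indep_aux (A B C : EuclideanSpace ℝ (Fin 2))
    (hABC : AffineIndependent ℝ ![A, B, C]) (x y : ℝ)
    (h : x • (B - A) + y • (C - A) = 0) : x = 0 ∧ y = 0 := by
  rw [affineIndependent_iff] at hABC
  have key := hABC Finset.univ ![-(x + y), x, y]
    (by simp [Fin.sum_univ_three])
    (by
      simp only [Fin.sum_univ_three, Matrix.cons_val]
      rw [← h]; module)
  have h1 := key 1 (Finset.mem_univ _)
  have h2 := key 2 (Finset.mem_univ _)
  simp only [Matrix.cons_val] at h1 h2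
  exact ⟨h1, h2⟩

theorem gergonne_pararadius_AE_CE
    (A B C D : EuclideanSpace ℝ (Fin 2))
    (hABC : AffineIndependent ℝ ![A, B, C])
    (a b c s : ℝ)
    (ha : a = dist B C) (hb : b = dist C A) (hc : c = dist A B)
    (hs : s = (a + b + c) / 2)
    (X Y Z : EuclideanSpace ℝ (Fin 2))
    (hX : X ∈ segment ℝ B C) (hXd : dist B X = s - b)
    (hY : Y ∈ segment ℝ C A) (hYd : dist C Y = s - c)
    (hZ : Z ∈ segment ℝ A B) (hZd : dist A Z = s - a)
    (hD1 : D ∈ affineSpan ℝ ({A, X} : Set (EuclideanSpace ℝ (Fin 2))))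
    (hD2 : D ∈ affineSpan ℝ ({B, Y} : Set (EuclideanSpace ℝ (Fin 2))))
    (hD3 : D ∈ affineSpan ℝ ({C, Z} : Set (EuclideanSpace ℝ (Fin 2))))
    (E : EuclideanSpace ℝ (Fin 2))
    (hE : E ∈ affineSpan ℝ ({A, C} : Set (EuclideanSpace ℝ (Fin 2))))
    (hEpar : ∃ t : ℝ, E - D = t • (C - B))
    :
    dist A E * (2 * a * b + 2 * b * c + 2 * c * a - a ^ 2 - b ^ 2 - c ^ 2) =
        2 * a * b * (b + c - a) ∧
      dist C E * (2 * a * b + 2 * b * c + 2 * c * a - a ^ 2 - b ^ 2 - c ^ 2) =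
        b * (a + b - c) * (a - b + c) := by
  obtain ⟨u, ⟨hu0, hu1⟩, rfl⟩ := (segment_eq_image_lineMap ℝ B C ▸ hX)
  obtain ⟨v, ⟨hv0, hv1⟩, rfl⟩ := (segment_eq_image_lineMap ℝ C A ▸ hY)
  obtain ⟨k, hk⟩ := (_root_.mem_affineSpan_pair_iff_exists_lineMap_eq).1 hD1
  obtain ⟨l, hl⟩ := (_root_.mem_affineSpan_pair_iff_exists_lineMap_eq).1 hD2
  obtain ⟨m, rfl⟩ := (_root_.mem_affineSpan_pair_iff_exists_lineMap_eq).1 hE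
  obtain ⟨t, ht⟩ := hEpar
  have hp : 0 ≤ s - a := hZd ▸ dist_nonneg
  have hq : 0 ≤ s - b := hXd ▸ dist_nonneg
  have hr : 0 ≤ s - c := hYd ▸ dist_nonneg
  have inj := hABC.injective
  have hAB : A ≠ B := fun h => by
    have := @inj 0 1 (by simpa using h)
    simp at this
  have hBC : B ≠ C := fun h => by
    have := @inj 1 2 (by simpa using h)
    simp at this
  have hCA : C ≠ A := fun h => by
    have := @inj 2 0 (by simpa using h)
    simp at this
  have ha0 : 0 < a := ha ▸ dist_pos.2 hBC
  have hb0 : 0 < b := hb ▸ dist_pos.2 hCA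
  have hc0 : 0 < c := hc ▸ dist_pos.2 hAB
  rw [dist_left_lineMap, Real.norm_of_nonneg hu0, ← ha] at hXd
  rw [dist_left_lineMap, Real.norm_of_nonneg hv0, ← hb] at hYd
  rw [dist_left_lineMap, dist_right_lineMap, dist_comm A C, ← hb]
  simp only [AffineMap.lineMap_apply_module'] at hk hl ht
  have e1 := indep_aux A B C hABC (k * (1 - u) - (1 - l)) (k * u - l * (1 - v)) (by
    have := hk.trans hl.symm
    rw [← sub_eq_zero] at this
    rw [← this]; module)
  have e2 := indep_aux A B C hABC (-(k * (1 - u)) + t) (m - k * u - t) (by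
    rw [← hk, ← sub_eq_zero] at ht
    rw [← ht]; module)
  obtain ⟨e1, e3⟩ := e1
  obtain ⟨e2, e4⟩ := e2
  have hmk : m = k := by linarith
  subst hmk
  obtain ⟨p, hpd⟩ : ∃ p, p = s - a := ⟨_, rfl⟩
  obtain ⟨q, hqd⟩ : ∃ p, p = s - b := ⟨_, rfl⟩
  obtain ⟨r, hrd⟩ : ∃ p, p = s - c := ⟨_, rfl⟩
  rw [← hpd] at hp
  rw [← hqd] at hq hXd
  rw [← hrd] at hr hYd
  have hA : a = q + r := by linarith
  have hB : b = p + r := by linarith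
  have hC : c = p + q := by linarith
  clear hpd hqd hrd hs ha hb hc
  subst hA hB hC
  have f1 : m * r = (1 - l) * (q + r) := by linear_combination (q + r) * e1 + m * hXd
  have f2 : m * q * (p + r) = l * p * (q + r) := by
    linear_combination (q + r) * (p + r) * e3 - m * (p + r) * hXd - l * (q + r) * hYd
  have f3 : m * (p * q + q * r + r * p) = p * (q + r) := by
    linear_combination p * f1 + f2
  have hσ : 0 < p * q + q * r + r * p := by
    have h1 := mul_nonneg hp hq
    have h2 := mul_nonneg hq hr
    have h3 := mul_nonneg hr hp
    rcases hp.eq_or_lt with h | h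
    · subst h
      have : 0 < q * r := mul_pos (by linarith) (by linarith)
      linarith
    · nlinarith [mul_pos h ha0]
  have hm0 : 0 ≤ m := by
    by_contra hh
    nlinarith [mul_nonneg hp ha0.le]
  have hm1 : 0 ≤ 1 - m := by
    by_contra hh
    nlinarith [mul_nonneg hq hr]
  rw [Real.norm_of_nonneg hm0, Real.norm_of_nonneg hm1]
  constructor
  · linear_combination 4 * (p + r) * f3
  · linear_combination -4 * (p + r) * f3
end

section
/- Let A, B, C be affinely independent points in the Euclidean plane, with a = dist B C, b = dist C A, c = dist A B, and let D be the Gergonne point of triangle ABC. Let F be the point on line AC and G the point on line AB such that both F − D and G − D are parallel to C − B (so FG is the Gergonne parachord parallel to BC). Then dist F G · (2ab + 2bc + 2ca − a² − b² − c²) = 2a²·(b + c − a). -/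
open EuclideanGeometry Real MeasureTheory RealInnerProductSpace

theorem aux_li {A B C : EuclideanSpace ℝ (Fin 2)}
    (h : AffineIndependent ℝ ![A, B, C]) (x y x' y' : ℝ)
    (e : x • (B - A) + y • (C - A) = x' • (B - A) + y' • (C - A)) : x = x' ∧ y = y' := by
  have h1 := (affineIndependent_iff_linearIndependent_vsub ℝ _ (0 : Fin 3)).1 h
  have h2 : LinearIndependent ℝ ![B - A, C - A] := by
    have h3 := h1.comp (fun i : Fin 2 => (⟨i.succ, by simp [Fin.succ_ne_zero]⟩ : {x : Fin 3 // x ≠ 0}))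
      (by intro i j hij; simpa using hij)
    have h4 : ((fun i : {x : Fin 3 // x ≠ 0} => (![A, B, C] i -ᵥ ![A, B, C] 0 : EuclideanSpace ℝ (Fin 2))) ∘
        fun i : Fin 2 => (⟨i.succ, by simp [Fin.succ_ne_zero]⟩ : {x : Fin 3 // x ≠ 0})) =
        ![B - A, C - A] := by
      funext i
      fin_cases i <;> simp
    rw [h4] at h3
    exact h3
  rw [LinearIndependent.pair_iff] at h2
  have := h2 (x - x') (y - y') (by
    rw [sub_smul, sub_smul]
    linear_combination (norm := module) e)
  constructor <;> linarith [this.1, this.2]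

theorem gergonne_parachord_formula
    (A B C D : EuclideanSpace ℝ (Fin 2))
    (hABC : AffineIndependent ℝ ![A, B, C])
    (a b c s : ℝ)
    (ha : a = dist B C) (hb : b = dist C A) (hc : c = dist A B)
    (hs : s = (a + b + c) / 2)
    (X Y Z : EuclideanSpace ℝ (Fin 2))
    (hX : X ∈ segment ℝ B C) (hXd : dist B X = s - b)
    (hY : Y ∈ segment ℝ C A) (hYd : dist C Y = s - c)
    (hZ : Z ∈ segment ℝ A B) (hZd : dist A Z = s - a)
    (hD1 : D ∈ affineSpan ℝ ({A, X} : Set (EuclideanSpace ℝ (Fin 2))))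
    (hD2 : D ∈ affineSpan ℝ ({B, Y} : Set (EuclideanSpace ℝ (Fin 2))))
    (hD3 : D ∈ affineSpan ℝ ({C, Z} : Set (EuclideanSpace ℝ (Fin 2))))
    (F G : EuclideanSpace ℝ (Fin 2))
    (hF : F ∈ affineSpan ℝ ({A, C} : Set (EuclideanSpace ℝ (Fin 2))))
    (hFpar : ∃ t : ℝ, F - D = t • (C - B))
    (hG : G ∈ affineSpan ℝ ({A, B} : Set (EuclideanSpace ℝ (Fin 2))))
    (hGpar : ∃ t : ℝ, G - D = t • (C - B)) :
    dist F G * (2 * a * b + 2 * b * c + 2 * c * a - a ^ 2 - b ^ 2 - c ^ 2) =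
      2 * a ^ 2 * (b + c - a) := by
  rw [segment_eq_image'] at hX
  obtain ⟨x, ⟨hx0, hx1⟩, rfl⟩ := hX
  rw [segment_eq_image'] at hY
  obtain ⟨y, ⟨hy0, hy1⟩, rfl⟩ := hY
  obtain ⟨d, rfl⟩ := (mem_affineSpan_pair_iff_exists_lineMap_eq).1 hD1
  obtain ⟨d2, hd2⟩ := (mem_affineSpan_pair_iff_exists_lineMap_eq).1 hD2
  obtain ⟨f, rfl⟩ := (mem_affineSpan_pair_iff_exists_lineMap_eq).1 hF
  obtain ⟨g, rfl⟩ := (mem_affineSpan_pair_iff_exists_lineMap_eq).1 hG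
  obtain ⟨t, ht⟩ := hFpar
  obtain ⟨t', ht'⟩ := hGpar
  simp only [AffineMap.lineMap_apply, vsub_eq_sub, vadd_eq_add] at *
  have e1 := aux_li hABC (1 - d2) (d2 * (1 - y)) (d * (1 - x)) (d * x) (by
    linear_combination (norm := module) hd2)
  have e2 := aux_li hABC (- (d * (1 - x))) (f - d * x) (-t) t (by
    linear_combination (norm := module) ht)
  have e3 := aux_li hABC (g - d * (1 - x)) (- (d * x)) (-t') t' (by
    linear_combination (norm := module) ht')
  have hf : f = d := by linarith [e2.1, e2.2]
  have hg : g = d := by linarith [e3.1, e3.2]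
  have hinj := hABC.injective
  have hBC : B ≠ C := fun h => by simpa using @hinj 1 2 (by simpa using h)
  have hCA : C ≠ A := fun h => by simpa using @hinj 2 0 (by simpa using h)
  have hAB : A ≠ B := fun h => by simpa using @hinj 0 1 (by simpa using h)
  have pa : 0 < a := ha ▸ dist_pos.2 hBC
  have pb : 0 < b := hb ▸ dist_pos.2 hCA
  have pc : 0 < c := hc ▸ dist_pos.2 hAB
  have p1 : 0 ≤ s - b := hXd ▸ dist_nonneg
  have p2 : 0 ≤ s - c := hYd ▸ dist_nonneg
  have p3 : 0 ≤ s - a := hZd ▸ dist_nonneg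
  have qx : x * a = s - b := by
    rw [← hXd, ha, dist_self_add_right, norm_smul, dist_comm, dist_eq_norm, Real.norm_of_nonneg hx0]
  have qy : y * b = s - c := by
    rw [← hYd, hb, dist_self_add_right, norm_smul, dist_comm, dist_eq_norm, Real.norm_of_nonneg hy0]
  have key : d * ((s - a) * (s - b) + (s - b) * (s - c) + (s - c) * (s - a)) = (s - a) * a := by
    have k : d * x = (1 - d * (1 - x)) * (1 - y) := by
      rw [← e1.1, ← e1.2]; ring
    have k2 : d * (x * a) * b = (a - d * (a - x * a)) * (b - y * b) := by
      linear_combination a * b * k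
    rw [qx, qy] at k2
    have : a = 2 * s - b - c := by linarith
    subst this
    linear_combination k2
  have hpos : 0 < (s - a) * (s - b) + (s - b) * (s - c) + (s - c) * (s - a) := by
    have r1 : 0 < (s - b) + (s - c) := by linarith
    have r2 : 0 < (s - a) + (s - c) := by linarith
    have r3 : 0 < (s - a) + (s - b) := by linarith
    generalize s - a = p at *
    generalize s - b = q at *
    generalize s - c = r at *
    rcases p3.eq_or_lt with h | h
    · subst h
      have : 0 < q * r := mul_pos (by linarith) (by linarith)
      linarith
    · have : 0 < p * (q + r) := mul_pos h r1
      nlinarith [mul_nonneg p1 p2]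
  have hd : 0 ≤ d := by
    by_contra hneg
    push Not at hneg
    have := mul_neg_of_neg_of_pos hneg hpos
    have := mul_nonneg p3 pa.le
    linarith
  have hdist : dist (f • (C - A) + A) (g • (B - A) + A) = d * a := by
    rw [hf, hg, dist_add_right, dist_smul₀, dist_sub_right, Real.norm_of_nonneg hd, ha, dist_comm C B]
  rw [hdist]
  subst hs
  linear_combination 4 * a * key
end

section
/- Let A, B, C be affinely independent points in the Euclidean plane, with a = dist B C, b = dist C A, c = dist A B, s = (a+b+c)/2, and let D be the Gergonne point of triangle ABC. Let d be the distance from D to the affine line through B and C (equivalently, dist D E where E is the orthogonal projection of D onto line BC). Then d · a · (2ab + 2bc + 2ca − a² − b² − c²) = 8·(s − b)·(s − c)·K, where K = √(s(s−a)(s−b)(s−c)). -/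
open EuclideanGeometry Real MeasureTheory RealInnerProductSpace

lemma aux_infDist (D B C : EuclideanSpace ℝ (Fin 2)) (h : 0 < dist B C) :
    Metric.infDist D (affineSpan ℝ ({B, C} : Set (EuclideanSpace ℝ (Fin 2))) : Set (EuclideanSpace ℝ (Fin 2))) * dist B C
      = |(D 0 - B 0) * (C 1 - B 1) - (D 1 - B 1) * (C 0 - B 0)| := by
  have key : ∀ P Q : EuclideanSpace ℝ (Fin 2), dist P Q ^ 2 = (P 0 - Q 0)^2 + (P 1 - Q 1)^2 := by
    intro P Q
    rw [EuclideanSpace.dist_eq, Real.sq_sqrt (by positivity)]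
    simp [Fin.sum_univ_two, Real.dist_eq, sq_abs]
  have hk := key B C
  have hne : (dist B C)^2 ≠ 0 := by positivity
  apply le_antisymm
  · set t := ((D 0 - B 0) * (C 0 - B 0) + (D 1 - B 1) * (C 1 - B 1)) / (dist B C)^2 with ht
    have ht' : t * (dist B C)^2 = (D 0 - B 0) * (C 0 - B 0) + (D 1 - B 1) * (C 1 - B 1) := by
      rw [ht]; field_simp
    have hm : AffineMap.lineMap B C t ∈ (affineSpan ℝ ({B, C} : Set (EuclideanSpace ℝ (Fin 2)))) :=
      AffineMap.lineMap_mem_affineSpan_pair t B C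
    refine (mul_le_mul_of_nonneg_right (Metric.infDist_le_dist_of_mem hm) h.le).trans ?_
    refine abs_le_of_sq_le_sq' ?_ (abs_nonneg _) |>.2
    rw [sq_abs, mul_pow, key]
    simp only [AffineMap.lineMap_apply, vsub_eq_sub, vadd_eq_add, PiLp.add_apply, PiLp.smul_apply, PiLp.sub_apply, smul_eq_mul]
    rw [hk] at ht' ⊢
    apply le_of_eq
    linear_combination (t * ((B 0 - C 0)^2 + (B 1 - C 1)^2) - ((D 0 - B 0) * (C 0 - B 0) + (D 1 - B 1) * (C 1 - B 1))) * ht'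
  · rw [← div_le_iff₀ h]
    rw [Metric.le_infDist ⟨B, left_mem_affineSpan_pair ℝ B C⟩]
    intro P hP
    obtain ⟨t, rfl⟩ := mem_affineSpan_pair_iff_exists_lineMap_eq.1 hP
    rw [div_le_iff₀ h]
    refine abs_le_of_sq_le_sq' ?_ (by positivity) |>.2
    rw [sq_abs, mul_pow, key, hk]
    simp only [AffineMap.lineMap_apply, vsub_eq_sub, vadd_eq_add, PiLp.add_apply, PiLp.smul_apply, PiLp.sub_apply, smul_eq_mul]
    nlinarith [sq_nonneg ((D 0 - (t * (C 0 - B 0) + B 0)) * (C 0 - B 0) + (D 1 - (t * (C 1 - B 1) + B 1)) * (C 1 - B 1))]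

lemma aux_cross (A B C : EuclideanSpace ℝ (Fin 2)) (h : AffineIndependent ℝ ![A, B, C]) :
    (A 0 - B 0) * (C 1 - B 1) - (A 1 - B 1) * (C 0 - B 0) ≠ 0 := by
  intro h0
  by_cases hBC : B = C
  · have := h.injective.ne (show (1 : Fin 3) ≠ 2 by decide)
    exact this (by simpa using hBC)
  have hpos : 0 < dist B C := dist_pos.2 hBC
  have key : dist B C ^ 2 = (B 0 - C 0)^2 + (B 1 - C 1)^2 := by
    rw [EuclideanSpace.dist_eq, Real.sq_sqrt (by positivity)]
    simp [Fin.sum_univ_two, Real.dist_eq, sq_abs]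
  have hn : (B 0 - C 0)^2 + (B 1 - C 1)^2 ≠ 0 := by rw [← key]; positivity
  rw [affineIndependent_iff_not_collinear_set] at h
  apply h
  apply collinear_insert_of_mem_affineSpan_pair
  rw [mem_affineSpan_pair_iff_exists_lineMap_eq]
  refine ⟨((A 0 - B 0) * (C 0 - B 0) + (A 1 - B 1) * (C 1 - B 1)) / ((B 0 - C 0)^2 + (B 1 - C 1)^2), ?_⟩
  ext i
  fin_cases i
  · simp [AffineMap.lineMap_apply]
    field_simp
    linear_combination (-(C 1 - B 1)) * h0
  · simp [AffineMap.lineMap_apply]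
    field_simp
    linear_combination ((C 0 - B 0)) * h0

theorem gergonne_apothem_length
    (A B C D : EuclideanSpace ℝ (Fin 2))
    (hABC : AffineIndependent ℝ ![A, B, C])
    (a b c s : ℝ)
    (ha : a = dist B C) (hb : b = dist C A) (hc : c = dist A B)
    (hs : s = (a + b + c) / 2)
    (X Y Z : EuclideanSpace ℝ (Fin 2))
    (hX : X ∈ segment ℝ B C) (hXd : dist B X = s - b)
    (hY : Y ∈ segment ℝ C A) (hYd : dist C Y = s - c)
    (hZ : Z ∈ segment ℝ A B) (hZd : dist A Z = s - a)
    (hD1 : D ∈ affineSpan ℝ ({A, X} : Set (EuclideanSpace ℝ (Fin 2))))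
    (hD2 : D ∈ affineSpan ℝ ({B, Y} : Set (EuclideanSpace ℝ (Fin 2))))
    (hD3 : D ∈ affineSpan ℝ ({C, Z} : Set (EuclideanSpace ℝ (Fin 2))))
    :
    Metric.infDist D (affineSpan ℝ ({B, C} : Set (EuclideanSpace ℝ (Fin 2))) : Set (EuclideanSpace ℝ (Fin 2))) * a *
        (2 * a * b + 2 * b * c + 2 * c * a - a ^ 2 - b ^ 2 - c ^ 2) =
      8 * (s - b) * (s - c) * Real.sqrt (s * (s - a) * (s - b) * (s - c)) := by
  have key : ∀ P Q : EuclideanSpace ℝ (Fin 2), dist P Q ^ 2 = (P 0 - Q 0)^2 + (P 1 - Q 1)^2 := by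
    intro P Q
    rw [EuclideanSpace.dist_eq, Real.sq_sqrt (by positivity)]
    simp [Fin.sum_univ_two, Real.dist_eq, sq_abs]
  have hw := aux_cross A B C hABC
  have ha2 := key B C
  have hb2 := key C A
  have hc2 := key A B
  have hx0 : 0 ≤ s - a := hZd ▸ dist_nonneg
  have hy0 : 0 ≤ s - b := hXd ▸ dist_nonneg
  have hz0 : 0 ≤ s - c := hYd ▸ dist_nonneg
  rw [← ha] at ha2
  rw [← hb] at hb2
  rw [← hc] at hc2
  have ha0 : 0 ≤ a := ha ▸ dist_nonneg
  have hb0 : 0 ≤ b := hb ▸ dist_nonneg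
  have hc0 : 0 ≤ c := hc ▸ dist_nonneg
  set w := (A 0 - B 0) * (C 1 - B 1) - (A 1 - B 1) * (C 0 - B 0) with hwd
  have heron : s * (s - a) * (s - b) * (s - c) = (|w| / 2) ^ 2 := by
    rw [div_pow, sq_abs]
    have h1 : 16 * (s * (s - a) * (s - b) * (s - c)) = 4 * a^2 * c^2 - (a^2 + c^2 - b^2)^2 := by
      rw [hs]; ring
    have h2 : 4 * a^2 * c^2 - (a^2 + c^2 - b^2)^2 = 4 * w ^ 2 := by
      rw [ha2, hb2, hc2, hwd]; ring
    linarith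
  have hpos : 0 < s * (s - a) * (s - b) * (s - c) := by
    rw [heron]; have := abs_pos.2 hw; positivity
  have hx : 0 < s - a := lt_of_le_of_ne hx0 (by rintro h; simp [← h] at hpos)
  have hy : 0 < s - b := lt_of_le_of_ne hy0 (by rintro h; simp [← h] at hpos)
  have hz : 0 < s - c := lt_of_le_of_ne hz0 (by rintro h; simp [← h] at hpos)
  have hap : 0 < a := by linarith
  have hbp : 0 < b := by linarith
  rw [heron, Real.sqrt_sq (by positivity)]
  have hinf := aux_infDist D B C (ha ▸ hap)
  rw [← ha] at hinf
  rw [hinf]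
  rw [segment_eq_image_lineMap] at hX hY
  obtain ⟨t, ⟨ht0, -⟩, rfl⟩ := hX
  obtain ⟨u, ⟨hu0, -⟩, rfl⟩ := hY
  rw [dist_left_lineMap, ← ha, Real.norm_of_nonneg ht0] at hXd
  rw [dist_left_lineMap, ← hb, Real.norm_of_nonneg hu0] at hYd
  obtain ⟨k, hk⟩ := mem_affineSpan_pair_iff_exists_lineMap_eq.1 hD1
  obtain ⟨l, hl⟩ := mem_affineSpan_pair_iff_exists_lineMap_eq.1 hD2
  have hk0 := congrArg (fun P : EuclideanSpace ℝ (Fin 2) => P 0) hk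
  have hk1 := congrArg (fun P : EuclideanSpace ℝ (Fin 2) => P 1) hk
  have hl0 := congrArg (fun P : EuclideanSpace ℝ (Fin 2) => P 0) hl
  have hl1 := congrArg (fun P : EuclideanSpace ℝ (Fin 2) => P 1) hl
  simp only [AffineMap.lineMap_apply, vsub_eq_sub, vadd_eq_add, PiLp.add_apply, PiLp.smul_apply, PiLp.sub_apply, smul_eq_mul] at hk0 hk1 hl0 hl1
  have e1 : (D 0 - B 0) * (C 1 - B 1) - (D 1 - B 1) * (C 0 - B 0) = (1 - k) * w := by
    rw [← hk0, ← hk1, hwd]; ring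
  have e2 : (D 0 - B 0) * (C 1 - B 1) - (D 1 - B 1) * (C 0 - B 0) = l * u * w := by
    rw [← hl0, ← hl1, hwd]; ring
  have e3 : (D 0 - A 0) * (B 1 - A 1) - (D 1 - A 1) * (B 0 - A 0) = k * t * w := by
    rw [← hk0, ← hk1, hwd]; ring
  have e4 : (D 0 - A 0) * (B 1 - A 1) - (D 1 - A 1) * (B 0 - A 0) = l * (1 - u) * w := by
    rw [← hl0, ← hl1, hwd]; ring
  have f1 : 1 - k = l * u := mul_right_cancel₀ hw (e1.symm.trans e2)
  have f2 : k * t = l * (1 - u) := mul_right_cancel₀ hw (e3.symm.trans e4)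
  have f3 : (1 - k) * (1 - u) = k * t * u := by rw [f1, f2]; ring
  have f4 : (1 - k) * ((s - a) * a) = k * ((s - b) * (s - c)) := by
    have : (s - a) = (1 - u) * b := by linarith
    rw [this, ← hXd, ← hYd]
    linear_combination (a * b) * f3
  have f5 : (1 - k) * ((s - a) * a + (s - b) * (s - c)) = (s - b) * (s - c) := by
    linear_combination f4
  have f6 : 0 ≤ 1 - k := by
    by_contra hcon
    push Not at hcon
    have h1 : 0 < (s - a) * a + (s - b) * (s - c) := by positivity
    have h2 : 0 < (s - b) * (s - c) := by positivity
    exact absurd (mul_neg_of_neg_of_pos hcon h1) (by rw [f5]; exact not_lt.2 h2.le)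
  rw [e1, abs_mul, abs_of_nonneg f6]
  have f7 : 2 * a * b + 2 * b * c + 2 * c * a - a ^ 2 - b ^ 2 - c ^ 2 = 4 * ((s - a) * a + (s - b) * (s - c)) := by
    rw [hs]; ring
  rw [f7]
  linear_combination (4 * |w|) * f5
end

section
/- Let A, B, C be affinely independent points in the Euclidean plane, with a = dist B C, b = dist C A, c = dist A B, and let D be the Gergonne point of triangle ABC. Let d₁ be the distance from D to the line BC and d₂ the distance from D to the line AC. Then d₁ · a · (b + c − a) = d₂ · b · (c + a − b). -/
open EuclideanGeometry Real MeasureTheory RealInnerProductSpace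

lemma le_of_sq_le_sq_aux {x y : ℝ} (h : x ^ 2 ≤ y ^ 2) (hy : 0 ≤ y) : x ≤ y :=
  (le_abs_self x).trans (abs_le_of_sq_le_sq h hy)

lemma infDist_line_mul (P Q D : EuclideanSpace ℝ (Fin 2)) (hPQ : P ≠ Q) :
    Metric.infDist D (affineSpan ℝ ({P, Q} : Set (EuclideanSpace ℝ (Fin 2))) : Set (EuclideanSpace ℝ (Fin 2)))
      * dist P Q = |(Q 0 - P 0) * (D 1 - P 1) - (Q 1 - P 1) * (D 0 - P 0)| := by
  have hpos : 0 < dist P Q := dist_pos.2 hPQ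
  have hsq : ∀ U V : EuclideanSpace ℝ (Fin 2), dist U V ^ 2 = (U 0 - V 0)^2 + (U 1 - V 1)^2 := by
    intro U V
    rw [EuclideanSpace.dist_eq, Real.sq_sqrt (by positivity)]
    simp [Fin.sum_univ_two, Real.dist_eq, sq_abs]
  have hco : ∀ (r : ℝ) (i : Fin 2), (AffineMap.lineMap P Q r : EuclideanSpace ℝ (Fin 2)) i
      = P i + r * (Q i - P i) := by
    intro r i
    simp [AffineMap.lineMap_apply]
    ring
  apply le_antisymm
  · set n := dist P Q ^ 2 with hn
    have hn0 : n ≠ 0 := by positivity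
    have hnn := hsq P Q
    rw [← hn] at hnn
    set r := ((D 0 - P 0) * (Q 0 - P 0) + (D 1 - P 1) * (Q 1 - P 1)) / n with hr
    have hrn : r * n = (D 0 - P 0) * (Q 0 - P 0) + (D 1 - P 1) * (Q 1 - P 1) := by
      rw [hr]; field_simp
    have h1 := Metric.infDist_le_dist_of_mem (x := D)
      (show AffineMap.lineMap P Q r ∈ (affineSpan ℝ ({P, Q} : Set (EuclideanSpace ℝ (Fin 2))) : Set _) from
        AffineMap.lineMap_mem_affineSpan_pair r P Q)
    refine (mul_le_mul_of_nonneg_right h1 hpos.le).trans ?_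
    refine le_of_sq_le_sq_aux ?_ (abs_nonneg _)
    rw [mul_pow, sq_abs, ← hn, hsq, hco, hco]
    apply le_of_eq
    have e : ((D 0 - (P 0 + r * (Q 0 - P 0)))^2 + (D 1 - (P 1 + r * (Q 1 - P 1)))^2) * n
      = ((D 0 - P 0)^2 + (D 1 - P 1)^2) * n
        - 2 * (r * n) * ((D 0 - P 0) * (Q 0 - P 0) + (D 1 - P 1) * (Q 1 - P 1))
        + (r * n) * r * ((P 0 - Q 0)^2 + (P 1 - Q 1)^2) := by ring
    rw [e, ← hnn, mul_assoc (r * n) r n, hrn, hnn]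
    ring
  · rw [← div_le_iff₀ hpos]
    refine (Metric.le_infDist ⟨P, left_mem_affineSpan_pair ℝ P Q⟩).2 ?_
    intro y hy
    obtain ⟨r, rfl⟩ := mem_affineSpan_pair_iff_exists_lineMap_eq.1 hy
    rw [div_le_iff₀ hpos]
    refine le_of_sq_le_sq_aux ?_ (by positivity)
    rw [mul_pow, sq_abs, hsq, hsq, hco, hco]
    nlinarith [sq_nonneg ((D 0 - (P 0 + r * (Q 0 - P 0))) * (Q 0 - P 0) + (D 1 - (P 1 + r * (Q 1 - P 1))) * (Q 1 - P 1))]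

theorem gergonne_trilinear
    (A B C D : EuclideanSpace ℝ (Fin 2))
    (hABC : AffineIndependent ℝ ![A, B, C])
    (a b c s : ℝ)
    (ha : a = dist B C) (hb : b = dist C A) (hc : c = dist A B)
    (hs : s = (a + b + c) / 2)
    (X Y Z : EuclideanSpace ℝ (Fin 2))
    (hX : X ∈ segment ℝ B C) (hXd : dist B X = s - b)
    (hY : Y ∈ segment ℝ C A) (hYd : dist C Y = s - c)
    (hZ : Z ∈ segment ℝ A B) (hZd : dist A Z = s - a)
    (hD1 : D ∈ affineSpan ℝ ({A, X} : Set (EuclideanSpace ℝ (Fin 2))))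
    (hD2 : D ∈ affineSpan ℝ ({B, Y} : Set (EuclideanSpace ℝ (Fin 2))))
    (hD3 : D ∈ affineSpan ℝ ({C, Z} : Set (EuclideanSpace ℝ (Fin 2))))
    :
    Metric.infDist D (affineSpan ℝ ({B, C} : Set (EuclideanSpace ℝ (Fin 2))) : Set (EuclideanSpace ℝ (Fin 2))) *
        (a * (b + c - a)) =
      Metric.infDist D (affineSpan ℝ ({A, C} : Set (EuclideanSpace ℝ (Fin 2))) : Set (EuclideanSpace ℝ (Fin 2))) *
        (b * (c + a - b)) := by
  have hBC : B ≠ C := fun h => by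
    have := hABC.injective.ne (show (1 : Fin 3) ≠ 2 by decide)
    exact this (by simpa using h)
  have hAC : A ≠ C := fun h => by
    have := hABC.injective.ne (show (0 : Fin 3) ≠ 2 by decide)
    exact this (by simpa using h)
  have e1 := infDist_line_mul B C D hBC
  have e2 := infDist_line_mul A C D hAC
  rw [← ha] at e1
  rw [dist_comm A C, ← hb] at e2
  rw [← mul_assoc, ← mul_assoc, e1, e2]
  rw [segment_eq_image_lineMap] at hZ
  obtain ⟨θ, ⟨h0, h1⟩, rfl⟩ := hZ
  rw [dist_left_lineMap, ← hc, Real.norm_of_nonneg h0] at hZd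
  obtain ⟨t, rfl⟩ := mem_affineSpan_pair_iff_exists_lineMap_eq.1 hD3
  have k1 : b + c - a = 2 * (θ * c) := by rw [hZd, hs]; ring
  have k2 : c + a - b = 2 * ((1 - θ) * c) := by rw [sub_mul, hZd, hs]; ring
  rw [k1, k2]
  have hco : ∀ (U V : EuclideanSpace ℝ (Fin 2)) (r : ℝ) (i : Fin 2),
      (AffineMap.lineMap U V r : EuclideanSpace ℝ (Fin 2)) i = U i + r * (V i - U i) := by
    intro U V r i
    simp [AffineMap.lineMap_apply]
    ring
  simp only [hco]
  set K := t * ((B 0 - A 0) * (C 1 - A 1) - (B 1 - A 1) * (C 0 - A 0)) with hK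
  have m1 : ∀ x : ℝ, x = (1 - θ) * K → |x| = (1 - θ) * |K| := by
    rintro x rfl
    rw [abs_mul, abs_of_nonneg (by linarith)]
  have m2 : ∀ x : ℝ, x = -(θ * K) → |x| = θ * |K| := by
    rintro x rfl
    rw [abs_neg, abs_mul, abs_of_nonneg h0]
  refine (congrArg (fun u => u * _) (m1 _ ?_)).trans
    (Eq.trans ?_ (congrArg (fun u => u * _) (m2 _ ?_)).symm)
  · rw [hK]; ring
  · ring
  · rw [hK]; ring
end
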